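/- Let Q be a rack, n ≥ 1 an integer, A = (ℤ/nℤ)[h]/(h²) with ideal m = (h), and α: Q × Q → ℤ/nℤ a function satisfying α(x,y) + α(x^y,z) = α(x,z) + α(x^z,y^z) for all x,y,z ∈ Q. Let c: AQ² → AQ² be the Yang-Baxter operator c(x ⊗ y) = (1 + h·α(x,y)) · (y ⊗ x^y). Then c is equivalent to c_Q with respect to m if and only if α is a coboundary, i.e., there exists a function g: Q → ℤ/nℤ with α(x,y) = g(x^y) − g(x) for all x,y ∈ Q. -/

import Mathlib

open TensorProduct

noncomputable section

/-- A rack: a set with a binary operation `act x y = x ^ y` such that all right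
translations are bijective and the operation is right self-distributive. -/
structure YBRack (Q : Type*) where
  act : Q → Q → Q
  act_bijective : ∀ y : Q, Function.Bijective fun x => act x y
  self_distrib : ∀ x y z : Q, act (act x y) z = act (act x z) (act y z)

namespace YBRack

variable {Q : Type*} {A : Type*} [CommRing A]

/-- Right translation by `y` as a permutation of `Q`. -/
def rho (R : YBRack Q) (y : Q) : Equiv.Perm Q :=
  Equiv.ofBijective _ (R.act_bijective y)

/-- The inner automorphism group of a rack: the subgroup of `Perm Q` generated
by all right translations. -/
def Inn (R : YBRack Q) : Subgroup (Equiv.Perm Q) :=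
  Subgroup.closure (Set.range R.rho)

/-- Behavioural equivalence: `x ≡ y` iff `ϱ(x) = ϱ(y)`. -/
def BEquiv (R : YBRack Q) (x y : Q) : Prop := R.rho x = R.rho y

end YBRack
/-- Matrix of a linear endomorphism of `AQ ⊗ AQ`, via the identification of
`AQ ⊗ AQ` with the free module on `Q × Q`. -/
def mat2 (A : Type*) [CommRing A] {Q : Type*}
    (f : ((Q →₀ A) ⊗[A] (Q →₀ A)) →ₗ[A] ((Q →₀ A) ⊗[A] (Q →₀ A))) (p q : Q × Q) : A :=
  finsuppTensorFinsupp' A Q Q (f ((finsuppTensorFinsupp' A Q Q).symm (Finsupp.single p 1))) q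

/-- Matrix of a linear endomorphism of `AQ`. -/
def mat1 (A : Type*) [CommRing A] {Q : Type*}
    (f : (Q →₀ A) →ₗ[A] (Q →₀ A)) (x u : Q) : A :=
  f (Finsupp.single x 1) u

/-- The Yang–Baxter (braid) equation for an endomorphism of `M ⊗ M`, where
`c₁ = c ⊗ id` and `c₂ = id ⊗ c` act on `(M ⊗ M) ⊗ M`. -/
def YBE {A M : Type*} [CommRing A] [AddCommGroup M] [Module A M]
    (c : (M ⊗[A] M) →ₗ[A] (M ⊗[A] M)) : Prop :=
  (LinearMap.rTensor M c) ∘ₗ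
      ((TensorProduct.assoc A M M M).symm.toLinearMap ∘ₗ (LinearMap.lTensor M c) ∘ₗ
        (TensorProduct.assoc A M M M).toLinearMap) ∘ₗ (LinearMap.rTensor M c)
    = ((TensorProduct.assoc A M M M).symm.toLinearMap ∘ₗ (LinearMap.lTensor M c) ∘ₗ
        (TensorProduct.assoc A M M M).toLinearMap) ∘ₗ (LinearMap.rTensor M c) ∘ₗ
      ((TensorProduct.assoc A M M M).symm.toLinearMap ∘ₗ (LinearMap.lTensor M c) ∘ₗ
        (TensorProduct.assoc A M M M).toLinearMap)

/-- A Yang–Baxter operator: a bijective linear endomorphism of `M ⊗ M`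
satisfying the Yang–Baxter equation. -/
def IsYBOp {A M : Type*} [CommRing A] [AddCommGroup M] [Module A M]
    (c : (M ⊗[A] M) →ₗ[A] (M ⊗[A] M)) : Prop :=
  Function.Bijective c ∧ YBE c

/-- An endomorphism of `AQ ⊗ AQ` is entropic (with respect to the rack `R`)
if its matrix is quasi-diagonal and fully equivariant. -/
def Entropic2 {Q : Type*} (R : YBRack Q) (A : Type*) [CommRing A]
    (f : ((Q →₀ A) ⊗[A] (Q →₀ A)) →ₗ[A] ((Q →₀ A) ⊗[A] (Q →₀ A))) : Prop :=
  (∀ x y u v : Q, (¬ R.BEquiv x u ∨ ¬ R.BEquiv y v) → mat2 A f (x, y) (u, v) = 0) ∧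
  (∀ (x y u v : Q) (α β : R.Inn),
    mat2 A f ((α : Equiv.Perm Q) x, (β : Equiv.Perm Q) y)
        ((α : Equiv.Perm Q) u, (β : Equiv.Perm Q) v)
      = mat2 A f (x, y) (u, v))

open scoped Classical in
/-- Two Yang–Baxter operators are equivalent with respect to the ideal `m` if
they are conjugate by `α ⊗ α` for some automorphism `α` of `AQ` congruent to
the identity modulo `m`. -/
def YBEquivalent {Q A : Type*} [CommRing A] (m : Ideal A)
    (c c' : ((Q →₀ A) ⊗[A] (Q →₀ A)) →ₗ[A] ((Q →₀ A) ⊗[A] (Q →₀ A))) : Prop :=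
  ∃ α : (Q →₀ A) ≃ₗ[A] (Q →₀ A),
    (∀ x u : Q, (α (Finsupp.single x 1)) u - (if x = u then 1 else 0) ∈ m) ∧
    c' = (TensorProduct.congr α α).toLinearMap ∘ₗ c ∘ₗ (TensorProduct.congr α α).symm.toLinearMap

/-- The coefficient at `y ⊗ x ^ y` of the image of `s ⊗ t` under a diagonal deformation of
`c_Q` only involves the coefficients of `s` at `x` and of `t` at `y`. -/
theorem YBRack.coeff_diagonal_tmul {Q A : Type*} [CommRing A] (R : YBRack Q) (κ : Q → Q → A)
    (c : ((Q →₀ A) ⊗[A] (Q →₀ A)) →ₗ[A] ((Q →₀ A) ⊗[A] (Q →₀ A)))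
    (hc : ∀ x y : Q, c (Finsupp.single x (1 : A) ⊗ₜ[A] Finsupp.single y (1 : A))
      = κ x y • (Finsupp.single y (1 : A) ⊗ₜ[A] Finsupp.single (R.act x y) (1 : A)))
    (x y : Q) (s t : Q →₀ A) :
    finsuppTensorFinsupp' A Q Q (c (s ⊗ₜ[A] t)) (y, R.act x y) = κ x y * (s x * t y) := by
  classical
  have h : Finsupp.lapply (y, R.act x y) ∘ₗ (finsuppTensorFinsupp' A Q Q).toLinearMap ∘ₗ c
      = κ x y • (Finsupp.lapply (x, y) ∘ₗ (finsuppTensorFinsupp' A Q Q).toLinearMap) := by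
    ext u v
    by_cases hv : v = y
    · by_cases hu : u = x
      · simp [hc, hu, hv]
      · have hne : R.act u y ≠ R.act x y := fun e => hu ((R.act_bijective y).injective e)
        simp [hc, hu, hv, hne]
    · simp [hc, hv]
  simpa using LinearMap.congr_fun h (s ⊗ₜ[A] t)

/-- Conjugating a diagonal deformation of `c_Q` by the diagonal automorphism with entries `w`. -/
theorem YBRack.conj_diagonal {Q A : Type*} [CommRing A] (R : YBRack Q) (κ : Q → Q → A)
    (w : Q → A) (a : (Q →₀ A) ≃ₗ[A] (Q →₀ A))
    (ha : ∀ x, a (Finsupp.single x 1) = w x • Finsupp.single x 1)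
    (hκ : ∀ x y, w x * κ x y = w (R.act x y))
    (cQ c : ((Q →₀ A) ⊗[A] (Q →₀ A)) →ₗ[A] ((Q →₀ A) ⊗[A] (Q →₀ A)))
    (hcQ : ∀ x y : Q, cQ (Finsupp.single x (1 : A) ⊗ₜ[A] Finsupp.single y (1 : A))
      = Finsupp.single y (1 : A) ⊗ₜ[A] Finsupp.single (R.act x y) (1 : A))
    (hc : ∀ x y : Q, c (Finsupp.single x (1 : A) ⊗ₜ[A] Finsupp.single y (1 : A))
      = κ x y • (Finsupp.single y (1 : A) ⊗ₜ[A] Finsupp.single (R.act x y) (1 : A))) :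
    c = (TensorProduct.congr a a).toLinearMap ∘ₗ cQ ∘ₗ
      (TensorProduct.congr a a).symm.toLinearMap := by
  have h : c ∘ₗ (TensorProduct.congr a a).toLinearMap
      = (TensorProduct.congr a a).toLinearMap ∘ₗ cQ := by
    refine ((Finsupp.basisSingleOne (R := A) (ι := Q)).tensorProduct
      Finsupp.basisSingleOne).ext fun ⟨x, y⟩ => ?_
    rw [Module.Basis.tensorProduct_apply, Finsupp.coe_basisSingleOne]
    change c (a (Finsupp.single x 1) ⊗ₜ[A] a (Finsupp.single y 1))
      = TensorProduct.congr a a (cQ (Finsupp.single x 1 ⊗ₜ[A] Finsupp.single y 1))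
    rw [hcQ, TensorProduct.congr_tmul, ha, ha, ha]
    simp only [TensorProduct.smul_tmul_smul, map_smul, hc, smul_smul]
    congr 1
    rw [← hκ]
    ring
  rw [← LinearMap.comp_assoc, ← h, LinearMap.comp_assoc]
  refine LinearMap.ext fun z => ?_
  exact congrArg c ((TensorProduct.congr a a).apply_symm_apply z).symm

/-- The unit `1 + ε b` of the dual numbers. -/
def DualNumber.oneAddEpsUnit {K : Type*} [CommRing K] (b : K) : (DualNumber K)ˣ where
  val := 1 + DualNumber.eps * algebraMap K (DualNumber K) b
  inv := 1 - DualNumber.eps * algebraMap K (DualNumber K) b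
  val_inv := by ext <;> simp
  inv_val := by ext <;> simp

theorem DualNumber.fst_eq_zero_of_mem_span_eps {K : Type*} [CommRing K] {z : DualNumber K}
    (hz : z ∈ Ideal.span {(DualNumber.eps : DualNumber K)}) : TrivSqZeroExt.fst z = 0 := by
  obtain ⟨b, rfl⟩ := Ideal.mem_span_singleton.mp hz
  simp

/-- (Triviality of diagonal deformations and rack coboundaries.)
Over the dual numbers `A = (ℤ/nℤ)[h]/(h²)` with `m = (h)`, the Yang–Baxter
deformation `c(x ⊗ y) = (1 + h·α(x,y)) · (y ⊗ x^y)` of `c_Q` associated with an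
additive rack 2-cocycle `α` is equivalent to `c_Q` iff `α` is a coboundary. -/
theorem diagonal_deformation_trivial_iff_coboundary
    {Q : Type*} (R : YBRack Q) (n : ℕ) (hn : 1 ≤ n)
    (α : Q → Q → ZMod n)
    (hα : ∀ x y z : Q, α x y + α (R.act x y) z = α x z + α (R.act x z) (R.act y z))
    (cQ : ((Q →₀ DualNumber (ZMod n)) ⊗[DualNumber (ZMod n)] (Q →₀ DualNumber (ZMod n)))
      →ₗ[DualNumber (ZMod n)]
      ((Q →₀ DualNumber (ZMod n)) ⊗[DualNumber (ZMod n)] (Q →₀ DualNumber (ZMod n))))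
    (hcQ : ∀ x y : Q,
      cQ (Finsupp.single x (1 : DualNumber (ZMod n)) ⊗ₜ[DualNumber (ZMod n)]
          Finsupp.single y (1 : DualNumber (ZMod n)))
        = Finsupp.single y (1 : DualNumber (ZMod n)) ⊗ₜ[DualNumber (ZMod n)]
            Finsupp.single (R.act x y) (1 : DualNumber (ZMod n)))
    (c : ((Q →₀ DualNumber (ZMod n)) ⊗[DualNumber (ZMod n)] (Q →₀ DualNumber (ZMod n)))
      →ₗ[DualNumber (ZMod n)]
      ((Q →₀ DualNumber (ZMod n)) ⊗[DualNumber (ZMod n)] (Q →₀ DualNumber (ZMod n))))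
    (hc : ∀ x y : Q,
      c (Finsupp.single x (1 : DualNumber (ZMod n)) ⊗ₜ[DualNumber (ZMod n)]
          Finsupp.single y (1 : DualNumber (ZMod n)))
        = (1 + DualNumber.eps * algebraMap (ZMod n) (DualNumber (ZMod n)) (α x y)) •
            (Finsupp.single y (1 : DualNumber (ZMod n)) ⊗ₜ[DualNumber (ZMod n)]
              Finsupp.single (R.act x y) (1 : DualNumber (ZMod n)))) :
    YBEquivalent (Ideal.span {(DualNumber.eps : DualNumber (ZMod n))}) cQ c ↔
      ∃ g : Q → ZMod n, ∀ x y : Q, α x y = g (R.act x y) - g x := by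
  classical
  constructor
  · rintro ⟨a, ha, hconj⟩
    have hfst : ∀ x, TrivSqZeroExt.fst (a (Finsupp.single x 1) x) = 1 := fun x => by
      have h := DualNumber.fst_eq_zero_of_mem_span_eps (ha x x)
      rw [if_pos rfl, TrivSqZeroExt.fst_sub, TrivSqZeroExt.fst_one] at h
      exact sub_eq_zero.mp h
    refine ⟨fun x => TrivSqZeroExt.snd (a (Finsupp.single x 1) x), fun x y => ?_⟩
    have hcoeff := R.coeff_diagonal_tmul _ c hc x y (a (Finsupp.single x 1))
      (a (Finsupp.single y 1))
    have himage : c (a (Finsupp.single x 1) ⊗ₜ a (Finsupp.single y 1))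
        = a (Finsupp.single y 1) ⊗ₜ a (Finsupp.single (R.act x y) 1) := by
      rw [hconj, ← TensorProduct.congr_tmul a a]
      simp [hcQ]
    rw [himage, finsuppTensorFinsupp'_apply_apply] at hcoeff
    have hsnd := congrArg TrivSqZeroExt.snd hcoeff
    simp [hfst, TrivSqZeroExt.algebraMap_eq_inl] at hsnd
    linear_combination -hsnd
  · rintro ⟨g, hg⟩
    let b : Module.Basis Q (DualNumber (ZMod n)) (Q →₀ DualNumber (ZMod n)) :=
      Finsupp.basisSingleOne
    let a := b.equiv (b.unitsSMul fun x => DualNumber.oneAddEpsUnit (g x)) (Equiv.refl Q)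
    have ha : ∀ x, a (Finsupp.single x 1)
        = (1 + DualNumber.eps * algebraMap (ZMod n) (DualNumber (ZMod n)) (g x)) •
          Finsupp.single x 1 := fun x => by
      have h := b.equiv_apply x (b.unitsSMul fun x => DualNumber.oneAddEpsUnit (g x))
        (Equiv.refl Q)
      rw [Module.Basis.unitsSMul_apply] at h
      simpa [a, b, Units.smul_def, DualNumber.oneAddEpsUnit] using h
    refine ⟨a, fun x u => ?_, R.conj_diagonal _ _ a ha (fun x y => ?_) cQ c hcQ hc⟩
    · rw [ha, Ideal.mem_span_singleton]
      by_cases hxu : x = u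
      · simp [hxu]
      · simp [hxu]
    · rw [hg]
      ext <;> simp


end
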